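/- Let U be a finite nonempty set and let 𝒜 be a finite subset of Π(U) × ℕ (a finite set of weighted partitions of U). Then there exists ℛ ⊆ 𝒜 with |ℛ| ≤ 2^{|U|−1} such that ℛ represents 𝒜. -/

import Mathlib

/-- A set `ℛ` of weighted partitions of `U` (partitions encoded as setoids on `U`)
*represents* a set `𝒜` if for every partition `Q` of `U`, the minimum weight of a pair
`(P,w)` with `P ⊔ Q = {U}` (join in the partition lattice; `{U}` is the one-block
partition, i.e. `⊤`) is the same over `𝒜` as over `ℛ`; minima are taken in `ℕ∪{∞}` with
`min ∅ = ∞`. -/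
def RepresentsW {U : Type} (A R : Set (Setoid U × ℕ)) : Prop :=
  ∀ Q : Setoid U,
    sInf {w : ℕ∞ | ∃ p ∈ A, p.1 ⊔ Q = ⊤ ∧ w = (p.2 : ℕ∞)} =
    sInf {w : ℕ∞ | ∃ p ∈ R, p.1 ⊔ Q = ⊤ ∧ w = (p.2 : ℕ∞)}

open scoped Classical in
/-- A minimum weight basis: a linearly independent subfamily such that every vector of the family
is spanned by basis vectors of no larger weight. -/
theorem exists_linearIndepOn_forall_mem_span_weight_le {K V ι : Type*} [Field K] [AddCommGroup V]
    [Module K V] (v : ι → V) (w : ι → ℕ) (s : Finset ι) :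
    ∃ t ⊆ s, LinearIndepOn K v (t : Set ι) ∧
      ∀ a ∈ s, v a ∈ Submodule.span K (v '' {b | b ∈ t ∧ w b ≤ w a}) := by
  induction s using Finset.induction_on_max_value w with
  | empty => exact ⟨∅, subset_rfl, by simp, by simp⟩
  | insert a s has hmax ih =>
    obtain ⟨t, hts, hind, hspan⟩ := ih
    by_cases ha : v a ∈ Submodule.span K (v '' (t : Set ι))
    · refine ⟨t, hts.trans (Finset.subset_insert a s), hind, fun b hb => ?_⟩
      rcases Finset.mem_insert.1 hb with rfl | hb
      · refine Submodule.span_mono (Set.image_mono fun c hc => ?_) ha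
        exact ⟨hc, hmax c (hts hc)⟩
      · exact hspan b hb
    · refine ⟨insert a t, Finset.insert_subset_insert a hts, ?_, fun b hb => ?_⟩
      · rw [Finset.coe_insert]
        exact hind.insert ha
      · rcases Finset.mem_insert.1 hb with rfl | hb
        · exact Submodule.subset_span ⟨b, ⟨Finset.mem_insert_self b t, le_rfl⟩, rfl⟩
        · refine Submodule.span_mono (Set.image_mono fun c hc => ?_) (hspan b hb)
          exact ⟨Finset.mem_insert_of_mem hc.1, hc.2⟩

open scoped Classical in
/-- The two-colouring of `U` extending `f` in which the root `r` has colour `0`. -/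
noncomputable def rootedCut {U : Type} (r : U) (f : {u : U // u ≠ r} → ZMod 2) (u : U) : ZMod 2 :=
  if h : u = r then 0 else f ⟨u, h⟩

open scoped Classical in
/-- The row of the cut matrix belonging to the partition `P`: it records which rooted cuts
are constant on the blocks of `P`. -/
noncomputable def cutVector {U : Type} (r : U) (P : Setoid U) (f : {u : U // u ≠ r} → ZMod 2) :
    ZMod 2 :=
  if P ≤ Setoid.ker (rootedCut r f) then 1 else 0

theorem cutVector_mul_cutVector {U : Type} (r : U) (P Q : Setoid U)
    (f : {u : U // u ≠ r} → ZMod 2) :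
    cutVector r P f * cutVector r Q f = cutVector r (P ⊔ Q) f := by
  simp only [cutVector, sup_le_iff]
  split_ifs <;> simp_all

theorem rootedCut_add {U : Type} (r : U) (f g : {u : U // u ≠ r} → ZMod 2) (u : U) :
    rootedCut r (f + g) u = rootedCut r f u + rootedCut r g u := by
  unfold rootedCut
  split_ifs <;> simp

open scoped Classical in
theorem cutVector_top {U : Type} (r : U) (f : {u : U // u ≠ r} → ZMod 2) :
    cutVector r ⊤ f = if f = 0 then 1 else 0 := by
  unfold cutVector
  congr 1
  refine propext ⟨fun h => funext fun u => ?_, ?_⟩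
  · have := h (show (⊤ : Setoid U) u.1 r from trivial)
    simpa [Setoid.ker, Function.onFun, rootedCut, u.2] using this
  · rintro rfl x y -
    change rootedCut r 0 x = rootedCut r 0 y
    simp [rootedCut]

open scoped Classical in
theorem sum_cutVector {U : Type} [Fintype U] (r : U) (S : Setoid U) :
    ∑ f, cutVector r S f = if S = ⊤ then 1 else 0 := by
  split_ifs with hS
  · subst hS
    rw [Fintype.sum_eq_single 0 fun f hf => by rw [cutVector_top, if_neg hf], cutVector_top,
      if_pos rfl]
  · obtain ⟨x, hx⟩ : ∃ x, ¬ S x r := by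
      by_contra! h
      exact hS (eq_top_iff.2 fun a b _ => S.trans (h a) (S.symm (h b)))
    let g : {u : U // u ≠ r} → ZMod 2 := fun u => if S x u then 1 else 0
    have hxr : x ≠ r := fun h => hx (h ▸ S.refl x)
    have hg : ∀ u, rootedCut r g u = if S x u then 1 else 0 := by
      intro u
      by_cases hu : u = r
      · subst hu
        simp [rootedCut, hx]
      · simp [rootedCut, hu, g]
    have hgS : ∀ a b, S a b → rootedCut r g a = rootedCut r g b := by
      intro a b hab
      rw [hg, hg]
      have : S x a ↔ S x b := ⟨fun h => S.trans h hab, fun h => S.trans h (S.symm hab)⟩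
      simp [this]
    have hinv : ∀ f, cutVector r S (f + g) = cutVector r S f := by
      intro f
      unfold cutVector
      congr 1
      refine propext (forall_congr' fun a => forall_congr' fun b => forall_congr' fun hab => ?_)
      change rootedCut r _ a = rootedCut r _ b ↔ rootedCut r _ a = rootedCut r _ b
      rw [rootedCut_add, rootedCut_add, hgS a b hab, add_left_inj]
    refine Finset.sum_involution (fun f _ => f + g) (fun f _ => ?_) (fun f _ _ h => ?_)
      (fun _ _ => Finset.mem_univ _) (fun f _ => ?_)
    · rw [hinv]
      exact CharTwo.add_self_eq_zero _
    · have := congrFun (add_eq_left.1 h) ⟨x, hxr⟩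
      simp [g] at this
    · funext u
      simp [add_assoc, CharTwo.add_self_eq_zero]

/-- For a finite nonempty set `U` and any finite set `𝒜` of weighted
partitions of `U`, there is `ℛ ⊆ 𝒜` with `|ℛ| ≤ 2^{|U|−1}` representing `𝒜`. -/
theorem statement10 {U : Type} [Fintype U] [Nonempty U]
    (A : Set (Setoid U × ℕ)) (hA : A.Finite) :
    ∃ R ⊆ A, R.Finite ∧ R.ncard ≤ 2 ^ (Fintype.card U - 1) ∧ RepresentsW A R := by
  classical
  obtain ⟨r⟩ := ‹Nonempty U›
  obtain ⟨t, hts, hind, hspan⟩ := exists_linearIndepOn_forall_mem_span_weight_le (K := ZMod 2)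
    (fun p : Setoid U × ℕ => cutVector r p.1) Prod.snd hA.toFinset
  have htA : (t : Set (Setoid U × ℕ)) ⊆ A := fun p hp => hA.mem_toFinset.1 (hts hp)
  refine ⟨t, htA, t.finite_toSet, ?_, fun Q => le_antisymm ?_ ?_⟩
  · rw [Set.ncard_coe_finset]
    have := hind.linearIndependent.fintype_card_le_finrank
    simpa [Fintype.card_subtype_compl] using this
  · exact sInf_le_sInf fun w ⟨p, hp, h⟩ => ⟨p, htA hp, h⟩
  · refine le_sInf ?_
    rintro _ ⟨p, hp, hpQ, rfl⟩
    let φ := Fintype.linearCombination (ZMod 2) (cutVector r Q)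
    have hφ : ∀ P, φ (cutVector r P) = if P ⊔ Q = ⊤ then 1 else 0 := by
      intro P
      simp only [φ, Fintype.linearCombination_apply, smul_eq_mul, cutVector_mul_cutVector,
        sum_cutVector]
    obtain ⟨b, ⟨hbt, hbw⟩, hbQ⟩ : ∃ b, (b ∈ t ∧ b.2 ≤ p.2) ∧ b.1 ⊔ Q = ⊤ := by
      by_contra! h
      have hle : Submodule.span (ZMod 2)
          ((fun p : Setoid U × ℕ => cutVector r p.1) '' {b | b ∈ t ∧ b.2 ≤ p.2}) ≤
          LinearMap.ker φ := by
        rw [Submodule.span_le]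
        rintro _ ⟨b, hb, rfl⟩
        simp [hφ, h b hb]
      have := hle (hspan p (hA.mem_toFinset.2 hp))
      simp [hφ, hpQ] at this
    exact sInf_le_of_le (b := (b.2 : ℕ∞)) ⟨b, hbt, hbQ, rfl⟩ (by exact_mod_cast hbw)
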